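/- arXiv:1507.08181 — 2 statements merged into one kernel-verified Lean document; each statement's English description precedes it below -/
import Mathlib

section
/- Let F ∈ ℂ[x,y,s,t] be a polynomial of degree d that is not Cartesian. Then the set of points q = (s_q, t_q) ∈ ℂ² for which the polynomial F(x, y, s_q, t_q) ∈ ℂ[x,y] is identically zero has cardinality at most d². -/
open MvPolynomial

/-- Regard `G ∈ ℂ[x,y]` as a polynomial in `x,y,s,t`. -/
noncomputable def liftXY (p : MvPolynomial (Fin 2) ℂ) : MvPolynomial (Fin 4) ℂ :=
  rename (fun i : Fin 2 => (⟨i.val, by omega⟩ : Fin 4)) p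

/-- Regard `K ∈ ℂ[s,t]` as a polynomial in `x,y,s,t`. -/
noncomputable def liftST (p : MvPolynomial (Fin 2) ℂ) : MvPolynomial (Fin 4) ℂ :=
  rename (fun i : Fin 2 => (⟨i.val + 2, by omega⟩ : Fin 4)) p

/-- `F ∈ ℂ[x,y,s,t]` is Cartesian if `F = G·H + K·L` with `G ∈ ℂ[x,y]`, `K ∈ ℂ[s,t]`
non-constant. -/
def IsCartesian (F : MvPolynomial (Fin 4) ℂ) : Prop :=
  ∃ (G K : MvPolynomial (Fin 2) ℂ) (H L : MvPolynomial (Fin 4) ℂ),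
    G.totalDegree ≠ 0 ∧ K.totalDegree ≠ 0 ∧ F = liftXY G * H + liftST K * L

/-- Polynomials in two variables of degree at most `k`. -/
noncomputable abbrev VV (k : ℕ) : Submodule ℂ (MvPolynomial (Fin 2) ℂ) :=
  restrictTotalDegree (Fin 2) ℂ k

lemma finrank_VV (k : ℕ) : 2 * Module.finrank ℂ (VV k) = (k + 1) * (k + 2) := by
  have h1 : Module.finrank ℂ (VV k)
      = Nat.card ({ n : Fin 2 →₀ ℕ | (n.sum fun _ e => e) ≤ k } : Set (Fin 2 →₀ ℕ)) :=
    Module.finrank_eq_nat_card_basis (basisRestrictSupport ℂ _)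
  have h2 : Nat.card ({ n : Fin 2 →₀ ℕ | (n.sum fun _ e => e) ≤ k } : Set (Fin 2 →₀ ℕ))
      = ((Finset.range (k + 1)).sigma (fun i => Finset.range (i + 1))).card := by
    rw [← Nat.card_eq_finsetCard]
    refine Nat.card_congr ⟨fun n => ⟨⟨n.1 0 + n.1 1, n.1 0⟩, ?_⟩,
      fun s => ⟨Finsupp.equivFunOnFinite.symm ![s.1.2, s.1.1 - s.1.2], ?_⟩, ?_, ?_⟩
    · have := n.2
      rw [Set.mem_ofPred_eq, Finsupp.sum_fintype _ _ (by simp), Fin.sum_univ_two] at this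
      simp
      omega
    · have := s.2
      rw [Set.mem_ofPred_eq, Finsupp.sum_fintype _ _ (by simp), Fin.sum_univ_two]
      rw [Finset.mem_sigma, Finset.mem_range, Finset.mem_range] at this
      simp
      omega
    · intro n
      ext i
      fin_cases i <;> simp
    · rintro ⟨⟨a, b⟩, h⟩
      simp at h ⊢
      omega
  rw [h1, h2, Finset.card_sigma]
  simp only [Finset.card_range]
  clear h1 h2
  induction k with
  | zero => simp
  | succ k ih => rw [Finset.sum_range_succ, mul_add, ih]; ring

lemma exists_interp (S : Finset (Fin 2 → ℂ)) (q : Fin 2 → ℂ) :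
    ∃ e : MvPolynomial (Fin 2) ℂ, eval q e = 1 ∧ ∀ r ∈ S, r ≠ q → eval r e = 0 := by
  have h : ∀ r : Fin 2 → ℂ, ∃ e : MvPolynomial (Fin 2) ℂ, eval q e = 1 ∧ (r ≠ q → eval r e = 0) := by
    intro r
    by_cases hr : r = q
    · exact ⟨1, by simp, fun h => absurd hr h⟩
    · obtain ⟨i, hi⟩ := Function.ne_iff.mp hr
      refine ⟨C ((q i - r i)⁻¹) * (X i - C (r i)), ?_, fun _ => by simp⟩
      have : q i - r i ≠ 0 := sub_ne_zero.mpr (Ne.symm hi)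
      simp [this]
  choose e he1 he2 using h
  refine ⟨∏ r ∈ S, e r, ?_, ?_⟩
  · simp [map_prod, he1]
  · intro r hr hrq
    rw [map_prod]
    exact Finset.prod_eq_zero hr (he2 r hrq)

/-- A form of Bezout's inequality. -/
lemma bezout_ineq (p g : MvPolynomial (Fin 2) ℂ) (hp : Prime p) (hg : ¬ p ∣ g)
    (S : Finset (Fin 2 → ℂ)) (hSp : ∀ q ∈ S, eval q p = 0) (hSg : ∀ q ∈ S, eval q g = 0) :
    S.card ≤ p.totalDegree * g.totalDegree := by
  classical
  set m := p.totalDegree with hm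
  set n := g.totalDegree with hn
  have hg0 : g ≠ 0 := fun h => hg (h ▸ dvd_zero p)
  choose e he1 he2 using exists_interp S
  set j := S.sup (fun q => (e q).totalDegree) with hj
  -- the evaluation map
  let ev : VV (m + n + j) →ₗ[ℂ] (S → ℂ) :=
    (LinearMap.pi fun q : S => (aeval (R := ℂ) q.1).toLinearMap).domRestrict (VV (m + n + j))
  have hev : ∀ f q, ev f q = eval q.1 f.1 := fun f q => by
    simp [ev, aeval_eq_eval]
  have hsurj : Function.Surjective ev := by
    intro v
    refine ⟨⟨∑ q : S, C (v q) * e q.1, ?_⟩, ?_⟩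
    · rw [mem_restrictTotalDegree]
      apply totalDegree_finsetSum_le
      intro q _
      refine (totalDegree_mul _ _).trans ?_
      rw [totalDegree_C]
      have : (e q.1).totalDegree ≤ j := Finset.le_sup (f := fun q => (e q).totalDegree) q.2
      omega
    · ext r
      rw [hev]
      simp only [map_sum, map_mul, eval_C]
      rw [Finset.sum_eq_single r]
      · rw [he1, mul_one]
      · intro b _ hb
        rw [he2 b.1 r.1 r.2 (fun h => hb (Subtype.ext h.symm)), mul_zero]
      · simp
  let φ : (VV (n + j) × VV (m + j)) →ₗ[ℂ] MvPolynomial (Fin 2) ℂ :=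
    ((LinearMap.mulLeft ℂ p).comp (VV (n + j)).subtype).coprod
      ((LinearMap.mulLeft ℂ g).comp (VV (m + j)).subtype)
  have hφ : ∀ a b, φ (a, b) = p * a.1 + g * b.1 := fun a b => by simp [φ]
  have hφV : LinearMap.range φ ≤ VV (m + n + j) := by
    rintro _ ⟨⟨a, b⟩, rfl⟩
    rw [hφ, mem_restrictTotalDegree]
    have ha := (mem_restrictTotalDegree _ _ _).mp a.2
    have hb := (mem_restrictTotalDegree _ _ _).mp b.2
    refine (totalDegree_add _ _).trans (max_le ?_ ?_)
    · refine (totalDegree_mul _ _).trans ?_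
      omega
    · refine (totalDegree_mul _ _).trans ?_
      omega
  let ψ : VV j →ₗ[ℂ] MvPolynomial (Fin 2) ℂ × MvPolynomial (Fin 2) ℂ :=
    ((LinearMap.mulLeft ℂ (-g)).comp (VV j).subtype).prod
      ((LinearMap.mulLeft ℂ p).comp (VV j).subtype)
  have hψ : ∀ c, ψ c = (-g * c.1, p * c.1) := fun c => by simp [ψ]
  let ι : (VV (n + j) × VV (m + j)) →ₗ[ℂ] MvPolynomial (Fin 2) ℂ × MvPolynomial (Fin 2) ℂ :=
    (VV (n + j)).subtype.prodMap (VV (m + j)).subtype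
  have hι : Function.Injective ι :=
    Function.Injective.prodMap Subtype.val_injective Subtype.val_injective
  have hker : (LinearMap.ker φ).map ι ≤ LinearMap.range ψ := by
    rintro _ ⟨⟨a, b⟩, hab, rfl⟩
    have hab : p * a.1 + g * b.1 = 0 := by rw [← hφ]; exact hab
    have hd : p ∣ g * b.1 := ⟨-a.1, by linear_combination hab⟩
    obtain ⟨c, hc⟩ := (hp.dvd_or_dvd hd).resolve_left hg
    have ha : a.1 = -g * c := by
      apply mul_left_cancel₀ hp.ne_zero
      rw [hc] at hab
      linear_combination hab
    have hcd : c ∈ VV j := by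
      rw [mem_restrictTotalDegree]
      by_cases hc0 : c = 0
      · simp [hc0]
      have := (mem_restrictTotalDegree _ _ _).mp b.2
      rw [hc, totalDegree_mul_of_isDomain hp.ne_zero hc0] at this
      omega
    refine ⟨⟨c, hcd⟩, ?_⟩
    rw [hψ]
    exact Prod.ext ha.symm hc.symm
  have h1 : Module.finrank ℂ (LinearMap.ker φ) ≤ Module.finrank ℂ (VV j) := by
    rw [(Submodule.equivMapOfInjective ι hι (LinearMap.ker φ)).finrank_eq]
    exact (Submodule.finrank_mono hker).trans (LinearMap.finrank_range_le ψ)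
  have h2 := LinearMap.finrank_range_add_finrank_ker φ
  rw [Module.finrank_prod] at h2
  have h3 := LinearMap.finrank_range_add_finrank_ker ev
  rw [LinearMap.range_eq_top.mpr hsurj, finrank_top, Module.finrank_fintype_fun_eq_card,
    Fintype.card_coe] at h3
  have h4 : Module.finrank ℂ (LinearMap.range φ) ≤ Module.finrank ℂ (LinearMap.ker ev) := by
    rw [← (Submodule.comapSubtypeEquivOfLe hφV).finrank_eq]
    apply Submodule.finrank_mono
    rintro f ⟨⟨a, b⟩, hf⟩
    rw [LinearMap.mem_ker]
    ext q
    rw [hev]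
    have : f.1 = p * a.1 + g * b.1 := by rw [← hφ]; exact hf.symm
    rw [this]
    simp [hSp q.1 q.2, hSg q.1 q.2]
  have e1 := finrank_VV (m + n + j)
  have e2 := finrank_VV (n + j)
  have e3 := finrank_VV (m + j)
  have e4 := finrank_VV j
  nlinarith

lemma not_isUnit_totalDegree {K : MvPolynomial (Fin 2) ℂ} (h0 : K ≠ 0) (hK : ¬ IsUnit K) :
    K.totalDegree ≠ 0 := by
  intro h
  apply hK
  rw [totalDegree_eq_zero_iff_eq_C] at h
  rw [h] at h0 ⊢
  have : coeff 0 K ≠ 0 := fun h' => h0 (by rw [h', C_0])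
  exact (IsUnit.mk0 _ this).map C

lemma card_family {ι : Type*} (c : ι → MvPolynomial (Fin 2) ℂ) (d : ℕ)
    (hd : ∀ i, (c i).totalDegree ≤ d)
    (hc : ∀ K : MvPolynomial (Fin 2) ℂ, K.totalDegree ≠ 0 → ∃ i, ¬ K ∣ c i)
    (S : Finset (Fin 2 → ℂ)) (hS : ∀ q ∈ S, ∀ i, eval q (c i) = 0) : S.card ≤ d ^ 2 := by
  classical
  have key : ∀ f : MvPolynomial (Fin 2) ℂ, f ≠ 0 →
      (S.filter (fun q => eval q f = 0)).card ≤ f.totalDegree * d := by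
    intro f
    induction f using UniqueFactorizationMonoid.induction_on_prime with
    | h₁ => intro h; exact absurd rfl h
    | h₂ u hu =>
      intro _
      rw [Finset.filter_eq_empty_iff.mpr]
      · simp
      · intro q _
        exact (hu.map (eval q)).ne_zero
    | h₃ a p ha hp ih =>
      intro _
      rw [totalDegree_mul_of_isDomain hp.ne_zero ha, add_mul]
      obtain ⟨i, hi⟩ := hc p (not_isUnit_totalDegree hp.ne_zero hp.not_unit)
      have hb := bezout_ineq p (c i) hp hi (S.filter (fun q => eval q p = 0))
        (fun q hq => (Finset.mem_filter.mp hq).2) (fun q hq => hS q (Finset.mem_filter.mp hq).1 i)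
      have hb' := hb.trans (Nat.mul_le_mul_left _ (hd i))
      refine le_trans ?_ (add_le_add hb' (ih ha))
      refine le_trans (Finset.card_le_card ?_) (Finset.card_union_le _ _)
      intro q hq
      simp only [Finset.mem_filter, Finset.mem_union, map_mul, mul_eq_zero] at hq ⊢
      tauto
  obtain ⟨i, hi⟩ := hc (X 0) (by simp)
  have h0 : c i ≠ 0 := fun h => hi (h ▸ dvd_zero _)
  have := key (c i) h0
  rw [Finset.filter_true_of_mem (fun q hq => hS q hq i)] at this
  exact this.trans (by rw [sq]; exact Nat.mul_le_mul_right _ (hd i))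

/-- View a polynomial in four variables as one in `x,y` with coefficients in `ℂ[s,t]`. -/
noncomputable def split4 : MvPolynomial (Fin 4) ℂ →+* MvPolynomial (Fin 2) (MvPolynomial (Fin 2) ℂ) :=
  eval₂Hom (C.comp C) ![X 0, X 1, C (X 0), C (X 1)]

noncomputable def unsplit4 : MvPolynomial (Fin 2) (MvPolynomial (Fin 2) ℂ) →+* MvPolynomial (Fin 4) ℂ :=
  eval₂Hom (rename (fun i : Fin 2 => (⟨i.val + 2, by omega⟩ : Fin 4)) :
    MvPolynomial (Fin 2) ℂ →ₐ[ℂ] MvPolynomial (Fin 4) ℂ).toRingHom ![X 0, X 1]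

lemma unsplit_split (F : MvPolynomial (Fin 4) ℂ) : unsplit4 (split4 F) = F := by
  have : unsplit4.comp split4 = RingHom.id _ := by
    apply MvPolynomial.ringHom_ext
    · intro r; simp [unsplit4, split4]
    · intro i; fin_cases i <;> simp [unsplit4, split4] <;> rfl
  exact congrArg (fun f => f F) this

lemma unsplit_C (K : MvPolynomial (Fin 2) ℂ) : unsplit4 (C K) = liftST K := by
  simp [unsplit4, liftST]

lemma eval_split (F : MvPolynomial (Fin 4) ℂ) (v q : Fin 2 → ℂ) :
    eval v (map (eval q) (split4 F)) = eval ![v 0, v 1, q 0, q 1] F := by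
  have : ((eval v).comp (map (eval q))).comp split4 = eval ![v 0, v 1, q 0, q 1] := by
    apply MvPolynomial.ringHom_ext
    · intro r; simp [split4]
    · intro i; fin_cases i <;> simp [split4]
  exact congrArg (fun f => f F) this

lemma totalDegree_coeff_split (F : MvPolynomial (Fin 4) ℂ) (e : Fin 2 →₀ ℕ) :
    ((split4 F).coeff e).totalDegree ≤ F.totalDegree := by
  classical
  have h : split4 F = ∑ u ∈ F.support, X 0 ^ u 0 * X 1 ^ u 1 *
      C (C (coeff u F) * (X 0 ^ u 2 * X 1 ^ u 3)) := by
    simp only [split4, coe_eval₂Hom]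
    rw [eval₂_eq']
    refine Finset.sum_congr rfl fun u _ => ?_
    simp [Fin.prod_univ_four]
    ring
  rw [h, coeff_sum]
  apply totalDegree_finsetSum_le
  intro u hu
  rw [mul_comm, coeff_C_mul]
  have h2 : (X 0 ^ u 0 * X 1 ^ u 1 : MvPolynomial (Fin 2) (MvPolynomial (Fin 2) ℂ))
      = monomial (Finsupp.single 0 (u 0) + Finsupp.single 1 (u 1)) 1 := by
    simp [X_pow_eq_monomial, monomial_mul]
  rw [h2, coeff_monomial]
  split_ifs
  · have hu' := le_totalDegree hu
    rw [Finsupp.sum_fintype _ _ (by simp), Fin.sum_univ_four] at hu'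
    rw [mul_one]
    refine (totalDegree_mul _ _).trans ?_
    rw [totalDegree_C]
    have := totalDegree_mul (X 0 ^ u 2 : MvPolynomial (Fin 2) ℂ) (X 1 ^ u 3)
    rw [totalDegree_X_pow, totalDegree_X_pow] at this
    omega
  · simp

/-- If `F ∈ ℂ[x,y,s,t]` of degree `d` is not Cartesian, then there are at most `d²` points
`q = (s_q, t_q) ∈ ℂ²` for which the specialization `F(x, y, s_q, t_q)` vanishes
identically. -/
theorem degenerate_points_finite
    (F : MvPolynomial (Fin 4) ℂ) (d : ℕ) (hd : F.totalDegree = d)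
    (hF : ¬ IsCartesian F) :
    {q : ℂ × ℂ | ∀ x y : ℂ, eval ![x, y, q.1, q.2] F = 0}.Finite ∧
    {q : ℂ × ℂ | ∀ x y : ℂ, eval ![x, y, q.1, q.2] F = 0}.ncard ≤ d ^ 2 := by
  classical
  set A := {q : ℂ × ℂ | ∀ x y : ℂ, eval ![x, y, q.1, q.2] F = 0} with hA
  have hc : ∀ K : MvPolynomial (Fin 2) ℂ, K.totalDegree ≠ 0 →
      ∃ i, ¬ K ∣ (split4 F).coeff i := by
    intro K hK
    by_contra! hcon
    obtain ⟨L, hL⟩ := (C_dvd_iff_dvd_coeff K (split4 F)).mpr hcon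
    refine hF ⟨X 0, K, 0, unsplit4 L, by simp, hK, ?_⟩
    rw [mul_zero, zero_add, ← unsplit_C, ← map_mul, ← hL, unsplit_split]
  have hbound : ∀ T : Finset (ℂ × ℂ), (T : Set (ℂ × ℂ)) ⊆ A → T.card ≤ d ^ 2 := by
    intro T hT
    have hinj : Function.Injective (fun q : ℂ × ℂ => (![q.1, q.2] : Fin 2 → ℂ)) := by
      intro q r h
      exact Prod.ext (congrFun h 0) (congrFun h 1)
    rw [← Finset.card_image_of_injective T hinj]
    refine card_family (fun e => (split4 F).coeff e) d
      (fun e => hd ▸ totalDegree_coeff_split F e) hc _ ?_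
    intro q hq e
    obtain ⟨r, hr, rfl⟩ := Finset.mem_image.mp hq
    have hz : map (eval (![r.1, r.2] : Fin 2 → ℂ)) (split4 F) = 0 := by
      apply MvPolynomial.funext
      intro v
      rw [eval_split, map_zero]
      exact hT hr (v 0) (v 1)
    have := congrArg (coeff e) hz
    rwa [coeff_map, coeff_zero] at this
  have hfin : A.Finite := by
    by_contra hinf
    obtain ⟨T, hT, hcard⟩ := Set.Infinite.exists_subset_card_eq hinf (d ^ 2 + 1)
    have := hbound T hT
    omega
  refine ⟨hfin, ?_⟩
  rw [Set.ncard_eq_toFinset_card A hfin]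
  exact hbound _ (by simp)
end

section
/- Let F ∈ ℂ[x,y,s,t] be a polynomial of degree d. If F is not Cartesian, then there do not exist finite sets I, J ⊂ ℂ² with |I| > d² and |J| > d² such that F(p,q) = 0 for all p ∈ I and q ∈ J. Conversely, if F is (G,K)-Cartesian with G, K having infinite zero sets, then such arbitrarily large I, J exist (take I ⊆ Z(G), J ⊆ Z(K)). -/
open MvPolynomial

abbrev R2 := MvPolynomial (Fin 2) ℂ

theorem finrank_rtd (k : ℕ) :
    2 * Module.finrank ℂ (restrictTotalDegree (Fin 2) ℂ k) = (k + 1) * (k + 2) := by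
  have h : Module.finrank ℂ (restrictTotalDegree (Fin 2) ℂ k)
      = Nat.card {n : Fin 2 →₀ ℕ | (n.sum fun _ e => e) ≤ k} :=
    Module.finrank_eq_nat_card_basis (basisRestrictSupport ℂ _)
  rw [h]
  have hsum : ∀ n : Fin 2 →₀ ℕ, (n.sum fun _ e => e) = n 0 + n 1 := fun n => by
    rw [Finsupp.sum_fintype _ _ (fun _ => rfl), Fin.sum_univ_two]
  have h2 : Nat.card {n : Fin 2 →₀ ℕ | (n.sum fun _ e => e) ≤ k}
      = ((Finset.range (k+1)).sigma
          (fun i => Finset.HasAntidiagonal.antidiagonal i)).card := by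
    rw [← Fintype.card_coe, ← Nat.card_eq_fintype_card]
    refine Nat.card_eq_of_bijective (fun n => ⟨⟨n.1 0 + n.1 1, (n.1 0, n.1 1)⟩, ?_⟩) ⟨?_, ?_⟩
    · have := n.2
      rw [Set.mem_ofPred_eq, hsum] at this
      simp only [Finset.mem_sigma, Finset.mem_range, Finset.HasAntidiagonal.mem_antidiagonal, and_true]
      omega
    · rintro ⟨a, ha⟩ ⟨b, hb⟩ hab
      simp only [Subtype.mk.injEq, Sigma.mk.injEq, heq_eq_eq, Prod.mk.injEq] at hab
      refine Subtype.ext (Finsupp.ext fun i => ?_)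
      fin_cases i
      · exact hab.2.1
      · exact hab.2.2
    · rintro ⟨⟨i, ⟨a, b⟩⟩, h⟩
      simp only [Finset.mem_sigma, Finset.mem_range, Finset.HasAntidiagonal.mem_antidiagonal] at h
      obtain ⟨h1, rfl⟩ := h
      refine ⟨⟨Finsupp.equivFunOnFinite.symm ![a, b], ?_⟩, ?_⟩
      · rw [Set.mem_ofPred_eq, hsum]
        simp
        omega
      · simp
  rw [h2, Finset.card_sigma]
  simp only [Finset.Nat.card_antidiagonal]
  clear h h2
  induction k with
  | zero => simp
  | succ k ih => rw [Finset.sum_range_succ, mul_add, ih]; ring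

theorem exists_sep (I : Finset (ℂ × ℂ)) (p : ℂ × ℂ) :
    ∃ e : R2, eval ![p.1, p.2] e ≠ 0 ∧ ∀ q ∈ I, q ≠ p → eval ![q.1, q.2] e = 0 := by
  have h : ∀ q : ℂ × ℂ, ∃ l : R2, q ≠ p → eval ![p.1, p.2] l ≠ 0 ∧ eval ![q.1, q.2] l = 0 := by
    intro q
    by_cases h1 : q.1 = p.1
    · refine ⟨X 1 - C q.2, fun hne => ?_⟩
      have : q.2 ≠ p.2 := fun h2 => hne (Prod.ext h1 h2)
      simp [sub_eq_zero, this.symm]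
    · refine ⟨X 0 - C q.1, fun hne => ?_⟩
      simp [sub_eq_zero, Ne.symm h1]
  choose l hl using h
  refine ⟨∏ q ∈ I.erase p, l q, ?_, ?_⟩
  · rw [map_prod, Finset.prod_ne_zero_iff]
    intro q hq
    exact (hl q (Finset.ne_of_mem_erase hq)).1
  · intro q hq hne
    rw [map_prod]
    exact Finset.prod_eq_zero (Finset.mem_erase.2 ⟨hne, hq⟩) (hl q hne).2

theorem bezout (P Q : R2) (hP : P ≠ 0) (hQ : Q ≠ 0) (hPQ : IsRelPrime P Q)
    (I : Finset (ℂ × ℂ)) (hIP : ∀ p ∈ I, eval ![p.1, p.2] P = 0)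
    (hIQ : ∀ p ∈ I, eval ![p.1, p.2] Q = 0) :
    I.card ≤ P.totalDegree * Q.totalDegree := by
  set m := P.totalDegree with hm
  set n := Q.totalDegree with hn
  choose e he1 he2 using exists_sep I
  obtain ⟨l, hl⟩ : ∃ l, ∀ p ∈ I, (e p).totalDegree ≤ l :=
    ⟨I.sup fun p => (e p).totalDegree, fun p hp => Finset.le_sup (f := fun p => (e p).totalDegree) hp⟩
  let V := fun k => restrictTotalDegree (Fin 2) ℂ k
  let T0 : R2 →ₗ[ℂ] (I → ℂ) := LinearMap.pi fun p => (aeval ![p.1.1, p.1.2]).toLinearMap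
  have hT0 : ∀ f p, T0 f p = eval ![p.1.1, p.1.2] f := fun f p => by
    simp [T0, aeval_eq_eval]
  let T : V (l + m + n) →ₗ[ℂ] (I → ℂ) := T0.domRestrict _
  have hTs : Function.Surjective T := by
    intro v
    have hmem : ∑ p : I, (v p / eval ![p.1.1, p.1.2] (e p.1)) • e p.1 ∈ V (l+m+n) := by
      refine Submodule.sum_mem _ fun p _ => Submodule.smul_mem _ _ ?_
      rw [mem_restrictTotalDegree]
      have := hl p.1 p.2
      omega
    refine ⟨⟨_, hmem⟩, ?_⟩
    funext q
    simp only [T, LinearMap.domRestrict_apply, hT0, map_sum, smul_eval]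
    rw [Finset.sum_eq_single q]
    · exact div_mul_cancel₀ _ (he1 _)
    · intro p _ hpq
      rw [he2 p.1 q.1 q.2 (fun h => hpq (Subtype.ext h.symm)), mul_zero]
    · simp
  have hT := T.finrank_range_add_finrank_ker
  rw [LinearMap.range_eq_top.2 hTs, finrank_top, Module.finrank_fintype_fun_eq_card,
    Fintype.card_coe] at hT
  -- the multiplication map
  have hmul : ∀ a A : R2, ∀ i j, a.totalDegree ≤ i → A.totalDegree ≤ j →
      (a * A).totalDegree ≤ i + j := fun a A i j h1 h2 =>
    (totalDegree_mul _ _).trans (add_le_add h1 h2)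
  let Φ : (V (l + n) × V (l + m)) →ₗ[ℂ] V (l + m + n) :=
    LinearMap.codRestrict _
      ((LinearMap.mulRight ℂ P ∘ₗ (V (l+n)).subtype).coprod
        (LinearMap.mulRight ℂ Q ∘ₗ (V (l+m)).subtype)) (by
        rintro ⟨⟨a, ha⟩, ⟨b, hb⟩⟩
        simp only [V, mem_restrictTotalDegree] at ha hb
        refine Submodule.add_mem _ ?_ ?_
        · simp only [V, mem_restrictTotalDegree]
          refine (hmul a P _ _ ha le_rfl).trans (by omega)
        · simp only [V, mem_restrictTotalDegree]
          refine (hmul b Q _ _ hb le_rfl).trans (by omega))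
  have hΦv : ∀ x, (Φ x : R2) = x.1.1 * P + x.2.1 * Q := fun x => rfl
  have hΦT : LinearMap.range Φ ≤ LinearMap.ker T := by
    rintro _ ⟨⟨⟨a, ha⟩, ⟨b, hb⟩⟩, rfl⟩
    rw [LinearMap.mem_ker]
    funext p
    have : T0 (a * P + b * Q) p = 0 := by
      rw [hT0]; simp [hIP p.1 p.2, hIQ p.1 p.2]
    exact this
  have hΦ := Φ.finrank_range_add_finrank_ker
  have hr := Submodule.finrank_mono hΦT
  let Θ : V l →ₗ[ℂ] (V (l + n) × V (l + m)) :=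
    (LinearMap.codRestrict (V (l+n)) (LinearMap.mulRight ℂ Q ∘ₗ (V l).subtype) (by
      rintro ⟨a, ha⟩
      simp only [V, mem_restrictTotalDegree] at ha ⊢
      exact hmul a Q _ _ ha le_rfl)).prod
    (LinearMap.codRestrict (V (l+m)) (-(LinearMap.mulRight ℂ P ∘ₗ (V l).subtype)) (by
      rintro ⟨a, ha⟩
      refine Submodule.neg_mem _ ?_
      simp only [V, mem_restrictTotalDegree] at ha ⊢
      exact hmul a P _ _ ha le_rfl))
  have hk : LinearMap.ker Φ ≤ LinearMap.range Θ := by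
    rintro ⟨⟨a, ha⟩, ⟨b, hb⟩⟩ hab
    have h0 : a * P + b * Q = 0 := by
      have := hΦv ⟨⟨a, ha⟩, ⟨b, hb⟩⟩
      rw [LinearMap.mem_ker.1 hab] at this
      exact this.symm
    have hdvd : Q ∣ a := by
      refine hPQ.symm.dvd_of_dvd_mul_right (y := a) ?_
      exact ⟨-b, by linear_combination h0⟩
    obtain ⟨c, rfl⟩ := hdvd
    have hb' : b = -(c * P) := by
      apply mul_right_cancel₀ hQ
      linear_combination h0
    have hc : c ∈ V l := by
      simp only [V, mem_restrictTotalDegree] at ha ⊢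
      by_cases hc0 : c = 0
      · simp [hc0]
      · rw [totalDegree_mul_of_isDomain hQ hc0] at ha
        omega
    refine ⟨⟨c, hc⟩, ?_⟩
    refine Prod.ext (Subtype.ext ?_) (Subtype.ext ?_)
    · exact mul_comm c Q
    · exact hb'.symm
  have hk1 := Submodule.finrank_mono hk
  have hk2 := LinearMap.finrank_range_le Θ
  rw [Module.finrank_prod] at hΦ
  have d1 := finrank_rtd (l + n)
  have d2 := finrank_rtd (l + m)
  have d3 := finrank_rtd (l + m + n)
  have d4 := finrank_rtd l
  have key : I.card + Module.finrank ℂ (V (l+n)) + Module.finrank ℂ (V (l+m))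
      ≤ Module.finrank ℂ (V (l+m+n)) + Module.finrank ℂ (V l) := by omega
  simp only [V] at key
  nlinarith

theorem common_factor (S : Submodule ℂ R2) (d : ℕ) (hS : ∀ f ∈ S, f.totalDegree ≤ d)
    (I : Finset (ℂ × ℂ)) (hI : d ^ 2 < I.card) (hv : ∀ f ∈ S, ∀ p ∈ I, eval ![p.1, p.2] f = 0) :
    ∃ G : R2, G.totalDegree ≠ 0 ∧ ∀ f ∈ S, G ∣ f := by
  by_contra! hno
  have hnu : ∀ f : R2, f ≠ 0 → ¬ IsUnit f → f.totalDegree ≠ 0 := by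
    intro f hf hu h0
    rw [totalDegree_eq_zero_iff_eq_C] at h0
    rw [h0] at hu hf
    exact hu ((isUnit_iff_ne_zero.2 (fun h => hf (by rw [h, C_0]))).map C)
  obtain ⟨P, hPS, hP0⟩ : ∃ P ∈ S, P ≠ 0 := by
    obtain ⟨f, hf, hd⟩ := hno (X 0) (by simp)
    exact ⟨f, hf, fun h => hd (h ▸ dvd_zero _)⟩
  obtain ⟨p0, hp0⟩ : I.Nonempty := Finset.card_pos.1 (by omega)
  have hPu : ¬ IsUnit P := fun hu => by
    have := hu.map (eval ![p0.1, p0.2])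
    rw [hv P hPS p0 hp0] at this
    exact not_isUnit_zero this
  classical
  let fs := (UniqueFactorizationMonoid.factors P).toFinset
  have hfs : ∀ g ∈ fs, Irreducible g := fun g hg =>
    UniqueFactorizationMonoid.irreducible_of_factor g (Multiset.mem_toFinset.1 hg)
  let W : R2 → Submodule ℂ S := fun g =>
    ((Ideal.span {g}).restrictScalars ℂ).comap S.subtype
  have hW : ∀ g (x : S), x ∈ W g ↔ g ∣ x.1 := fun g x => by
    simp [W, Ideal.mem_span_singleton]
  have hcov := Subspace.biUnion_ne_univ_of_top_notMem (k := ℂ) (s := fs.image W) (by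
    intro ht
    obtain ⟨g, hg, hgt⟩ := Finset.mem_image.1 ht
    have hi := hfs g hg
    obtain ⟨f, hf, hnd⟩ := hno g (hnu g hi.ne_zero hi.not_isUnit)
    apply hnd
    have := (hW g ⟨f, hf⟩).1 (by rw [hgt]; trivial)
    exact this)
  obtain ⟨Q, hQ⟩ := (Set.ne_univ_iff_exists_notMem _).1 hcov
  have hQ' : ∀ g ∈ fs, ¬ g ∣ Q.1 := by
    intro g hg hd
    apply hQ
    simp only [Set.mem_iUnion]
    exact ⟨W g, Finset.mem_image_of_mem _ hg, (hW g Q).2 hd⟩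
  have hrel : ∀ ⦃h : R2⦄, h ∣ P → h ∣ Q.1 → ¬ Prime h := by
    intro h hhP hhQ hpr
    obtain ⟨g, hg, hassoc⟩ :=
      UniqueFactorizationMonoid.exists_mem_factors_of_dvd hP0 hpr.irreducible hhP
    exact hQ' g (Multiset.mem_toFinset.2 hg) (hassoc.symm.dvd.trans hhQ)
  have hPQ : IsRelPrime P Q.1 :=
    (UniqueFactorizationMonoid.isRelPrime_iff_no_prime_factors hP0).2 hrel
  have hQ0 : Q.1 ≠ 0 := by
    intro h
    rw [h] at hPQ
    exact hPu (hPQ dvd_rfl (dvd_zero _))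
  have := bezout P Q.1 hP0 hQ0 hPQ I (hv P hPS) (hv _ Q.2)
  have h2 := Nat.mul_le_mul (hS P hPS) (hS _ Q.2)
  rw [← sq] at h2
  omega


theorem exists_decomp (F : MvPolynomial (Fin 4) ℂ) :
    ∃ (a b : (Fin 4 →₀ ℕ) → R2),
      (∀ i ∈ F.support, (a i).totalDegree ≤ F.totalDegree) ∧
      (∀ i ∈ F.support, (b i).totalDegree ≤ F.totalDegree) ∧
      F = ∑ i ∈ F.support, liftXY (a i) * liftST (b i) := by
  have key : ∀ (i : Fin 4 →₀ ℕ) (c : ℂ), i.sum (fun _ e => e) = i 0 + i 1 + i 2 + i 3 := by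
    intro i c
    rw [Finsupp.sum_fintype _ _ (fun _ => rfl), Fin.sum_univ_four]
  refine ⟨fun i => C (coeff i F) * (X 0 ^ i 0 * X 1 ^ i 1), fun i => X 0 ^ i 2 * X 1 ^ i 3,
    ?_, ?_, ?_⟩
  · intro i hi
    refine le_trans ?_ (le_totalDegree hi)
    rw [key i 0]
    refine (totalDegree_mul _ _).trans ?_
    rw [totalDegree_C, zero_add]
    refine (totalDegree_mul _ _).trans ?_
    rw [totalDegree_X_pow, totalDegree_X_pow]
    omega
  · intro i hi
    refine le_trans ?_ (le_totalDegree hi)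
    rw [key i 0]
    refine (totalDegree_mul _ _).trans ?_
    rw [totalDegree_X_pow, totalDegree_X_pow]
    omega
  · conv_lhs => rw [F.as_sum]
    refine Finset.sum_congr rfl fun i _ => ?_
    rw [monomial_eq, Finsupp.prod_fintype _ _ (fun _ => pow_zero _), Fin.prod_univ_four]
    simp only [liftXY, liftST, map_mul, map_pow, rename_C, rename_X]
    simp only [mul_assoc]
    rfl

theorem eval_liftXY (G : R2) (p q : ℂ × ℂ) :
    eval ![p.1, p.2, q.1, q.2] (liftXY G) = eval ![p.1, p.2] G := by
  rw [liftXY, eval_rename]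
  congr 2
  funext i
  fin_cases i <;> rfl

theorem eval_liftST (G : R2) (p q : ℂ × ℂ) :
    eval ![p.1, p.2, q.1, q.2] (liftST G) = eval ![q.1, q.2] G := by
  rw [liftST, eval_rename]
  congr 2

theorem cartesian_of_vanish (F : MvPolynomial (Fin 4) ℂ) (d : ℕ) (hd : F.totalDegree = d)
    (I J : Finset (ℂ × ℂ)) (hI : d ^ 2 < I.card) (hJ : d ^ 2 < J.card)
    (h : ∀ p ∈ I, ∀ q ∈ J, eval ![p.1, p.2, q.1, q.2] F = 0) : IsCartesian F := by
  classical
  obtain ⟨a, b, ha, hb, hF⟩ := exists_decomp F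
  rw [hd] at ha hb
  set s := F.support
  have hev : ∀ p ∈ I, ∀ q ∈ J, ∑ i ∈ s, eval ![p.1, p.2] (a i) * eval ![q.1, q.2] (b i) = 0 := by
    intro p hp q hq
    have := h p hp q hq
    rw [hF, map_sum] at this
    simpa only [map_mul, eval_liftXY, eval_liftST] using this
  -- the factor `G`
  let A : (ℂ × ℂ) → R2 := fun q => ∑ i ∈ s, eval ![q.1, q.2] (b i) • a i
  obtain ⟨G, hG, hGd⟩ := common_factor (Submodule.span ℂ (Set.image A J)) d (by
      suffices Submodule.span ℂ (Set.image A J) ≤ restrictTotalDegree (Fin 2) ℂ d from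
        fun f hf => (mem_restrictTotalDegree _ _ _).1 (this hf)
      rw [Submodule.span_le]
      rintro _ ⟨q, _, rfl⟩
      exact Submodule.sum_mem _ fun i hi => Submodule.smul_mem _ _
        ((mem_restrictTotalDegree _ _ _).2 (ha i hi))) I hI (by
      intro f hf p hp
      induction hf using Submodule.span_induction with
      | mem x hx =>
        obtain ⟨q, hq, rfl⟩ := hx
        simp only [A, map_sum, smul_eval]
        rw [← hev p hp q hq]
        exact Finset.sum_congr rfl fun i _ => mul_comm _ _
      | zero => simp
      | add x y _ _ hx hy => rw [map_add, hx, hy, add_zero]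
      | smul c x _ hx => rw [smul_eval, hx, mul_zero])
  have hGA : ∀ q ∈ J, G ∣ A q := fun q hq => hGd _ (Submodule.subset_span ⟨q, hq, rfl⟩)
  -- the factor `K`
  let B : (R2 →ₗ[ℂ] ℂ) → R2 := fun φ => ∑ i ∈ s, φ (a i) • b i
  let D : Set (R2 →ₗ[ℂ] ℂ) := {φ | ∀ f, G ∣ f → φ f = 0}
  obtain ⟨K, hK, hKd⟩ := common_factor (Submodule.span ℂ (Set.image B D)) d (by
      suffices Submodule.span ℂ (Set.image B D) ≤ restrictTotalDegree (Fin 2) ℂ d from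
        fun f hf => (mem_restrictTotalDegree _ _ _).1 (this hf)
      rw [Submodule.span_le]
      rintro _ ⟨q, _, rfl⟩
      exact Submodule.sum_mem _ fun i hi => Submodule.smul_mem _ _
        ((mem_restrictTotalDegree _ _ _).2 (hb i hi))) J hJ (by
      intro f hf q hq
      induction hf using Submodule.span_induction with
      | mem x hx =>
        obtain ⟨φ, hφ, rfl⟩ := hx
        have := hφ _ (hGA q hq)
        simp only [A, map_sum, map_smul, smul_eq_mul] at this
        simp only [B, map_sum, smul_eval]
        rw [← this]
        exact Finset.sum_congr rfl fun i _ => mul_comm _ _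
      | zero => simp
      | add x y _ _ hx hy => rw [map_add, hx, hy, add_zero]
      | smul c x _ hx => rw [smul_eval, hx, mul_zero])
  have hKB : ∀ φ ∈ D, K ∣ B φ := fun q hq => hKd _ (Submodule.subset_span ⟨q, hq, rfl⟩)
  -- reduction modulo `G`
  let N : Submodule ℂ R2 := (Ideal.span {G}).restrictScalars ℂ
  have hN : ∀ f, f ∈ N ↔ G ∣ f := fun f => by simp [N, Ideal.mem_span_singleton]
  let bs := Module.Basis.ofVectorSpace ℂ (R2 ⧸ N)
  let g := fun j => Function.surjInv N.mkQ_surjective (bs j)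
  have hg : ∀ j, N.mkQ (g j) = bs j := fun j => Function.surjInv_eq N.mkQ_surjective (bs j)
  let φ := fun j => (bs.coord j) ∘ₗ N.mkQ
  have hφ : ∀ j, φ j ∈ D := by
    intro j f hf
    have : N.mkQ f = 0 := by
      rw [Submodule.mkQ_apply, Submodule.Quotient.mk_eq_zero]
      exact (hN f).2 hf
    simp only [φ, LinearMap.comp_apply, this, map_zero]
  let t := s.biUnion fun i => (bs.repr (N.mkQ (a i))).support
  have hred : ∀ i ∈ s, G ∣ a i - ∑ j ∈ t, φ j (a i) • g j := by
    intro i hi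
    rw [← hN, ← Submodule.Quotient.mk_eq_zero, ← Submodule.mkQ_apply, map_sub, map_sum]
    simp only [map_smul, hg]
    rw [sub_eq_zero]
    conv_lhs => rw [← bs.linearCombination_repr (N.mkQ (a i)), Finsupp.linearCombination_apply]
    rw [Finsupp.sum_of_support_subset (s := t) _ (Finset.subset_biUnion_of_mem
      (fun i => (bs.repr (N.mkQ (a i))).support) hi) _ (by simp)]
    rfl
  choose! r hr using hred
  choose! k hk using hKB
  refine ⟨G, K, ∑ i ∈ s, liftXY (r i) * liftST (b i),
    ∑ j ∈ t, liftXY (g j) * liftST (k (φ j)), hG, hK, ?_⟩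
  have hai : ∀ i ∈ s, a i = G * r i + ∑ j ∈ t, φ j (a i) • g j := fun i hi => by
    rw [← hr i hi]; ring
  have h1 : ∀ i ∈ s, liftXY (a i) * liftST (b i) = liftXY G * (liftXY (r i) * liftST (b i))
      + ∑ j ∈ t, liftXY (g j) * liftST (φ j (a i) • b i) := by
    intro i hi
    conv_lhs => rw [hai i hi]
    simp only [liftXY, liftST, map_add, map_mul, map_sum, map_smul, add_mul, Finset.sum_mul,
      smul_mul_assoc, mul_smul_comm, mul_assoc]
  rw [hF, Finset.sum_congr rfl h1, Finset.sum_add_distrib, ← Finset.mul_sum, Finset.sum_comm]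
  congr 1
  rw [Finset.mul_sum]
  refine Finset.sum_congr rfl fun j _ => ?_
  rw [← Finset.mul_sum]
  have : ∑ i ∈ s, liftST (φ j (a i) • b i) = liftST K * liftST (k (φ j)) := by
    have e := hk (φ j) (hφ j)
    simp only [liftST, ← map_sum, ← map_mul]
    rw [← e]
  rw [this]
  ring

/-- Second Nullstellensatz for two-dimensional products. If `F` of degree `d` is not
Cartesian, there are no finite sets `I, J ⊂ ℂ²` with `|I|, |J| > d²` and `I × J ⊆ Z(F)`.
Conversely, if `F` is `(G,K)`-Cartesian with `Z(G)` and `Z(K)` infinite, then arbitrarily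
large such `I ⊆ Z(G)`, `J ⊆ Z(K)` exist. -/
theorem second_nullstellensatz_two_dim_products
    (F : MvPolynomial (Fin 4) ℂ) (d : ℕ) (hd : F.totalDegree = d) :
    (¬ IsCartesian F →
      ¬ ∃ I J : Finset (ℂ × ℂ), d ^ 2 < I.card ∧ d ^ 2 < J.card ∧
        ∀ p ∈ I, ∀ q ∈ J, eval ![p.1, p.2, q.1, q.2] F = 0) ∧
    (∀ (G K : MvPolynomial (Fin 2) ℂ) (H L : MvPolynomial (Fin 4) ℂ),
      G.totalDegree ≠ 0 → K.totalDegree ≠ 0 → F = liftXY G * H + liftST K * L →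
      {p : ℂ × ℂ | eval ![p.1, p.2] G = 0}.Infinite →
      {q : ℂ × ℂ | eval ![q.1, q.2] K = 0}.Infinite →
      ∀ n : ℕ, ∃ I J : Finset (ℂ × ℂ),
        ↑I ⊆ {p : ℂ × ℂ | eval ![p.1, p.2] G = 0} ∧
        ↑J ⊆ {q : ℂ × ℂ | eval ![q.1, q.2] K = 0} ∧
        n ≤ I.card ∧ n ≤ J.card ∧
        ∀ p ∈ I, ∀ q ∈ J, eval ![p.1, p.2, q.1, q.2] F = 0) := by
  refine ⟨fun hF ⟨I, J, hI, hJ, h⟩ => hF (cartesian_of_vanish F d hd I J hI hJ h), ?_⟩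
  intro G K H L _ _ hF hGi hKi n
  obtain ⟨I, hI, hIn⟩ := hGi.exists_subset_card_eq n
  obtain ⟨J, hJ, hJn⟩ := hKi.exists_subset_card_eq n
  refine ⟨I, J, hI, hJ, hIn.ge, hJn.ge, fun p hp q hq => ?_⟩
  have h1 : eval ![p.1, p.2] G = 0 := hI hp
  have h2 : eval ![q.1, q.2] K = 0 := hJ hq
  rw [hF, map_add, map_mul, map_mul, eval_liftXY, eval_liftST, h1, h2, zero_mul, zero_mul,
    add_zero]
end
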